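/- Let X be a metric space, let C ≥ 0, and let x, y, z, q ∈ X. Suppose q lies on a geodesic from z to x, i.e. dist z q + dist q x = dist z x, and suppose there exists a point p lying on a geodesic from x to y, i.e. dist x p + dist p y = dist x y, with dist q p ≤ C (so q lies in the closed C-neighborhood of a geodesic [x,y]). Then |⟨x,y⟩_z − ⟨q,y⟩_z| ≤ C, where ⟨·,·⟩_z denotes the Gromov product based at z. -/

import Mathlib

/-- Gromov product of `a` and `b` with respect to basepoint `c`. -/
noncomputable def gromovProduct {X : Type*} [MetricSpace X] (c a b : X) : ℝ :=
  (dist a c + dist b c - dist a b) / 2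

theorem gromov_product_go_far_enough {X : Type*} [MetricSpace X]
    (C : ℝ) (hC : 0 ≤ C) (x y z q : X)
    (hq : dist z q + dist q x = dist z x)
    (hp : ∃ p : X, dist x p + dist p y = dist x y ∧ dist q p ≤ C) :
    |gromovProduct z x y - gromovProduct z q y| ≤ C := by
  obtain ⟨p, hp, hqp⟩ := hp
  have hqx : dist q x ≤ dist q p + dist x p := dist_triangle_right q x p
  have hqy : dist q y ≤ dist q p + dist p y := dist_triangle q p y
  have hxy : dist x y ≤ dist q x + dist q y := dist_triangle_left x y q
  unfold gromovProduct
  rw [dist_comm x z, dist_comm q z, abs_le]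
  constructor <;> linarith
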